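/- arXiv:1209.3345 — 3 statements merged into one kernel-verified Lean document; each statement's English description precedes it below -/
import Mathlib

section
/- For a prime power q and n ≥ 1, the number of monic squarefree polynomials of degree n over the finite field F_q with nonzero constant term equals (q^{n+1} - q^n + (-1)^{n+1}(q-1))/(q+1). -/
open Polynomial in
theorem aux_dvd {F : Type*} [Field F] {a b c d : F[X]} (hb : b ≠ 0)
    (hc : Squarefree c) (h : a * b ^ 2 = c * d ^ 2) : b ∣ d := by
  classical
  obtain ⟨b', d', hbd⟩ := extract_gcd b d
  obtain ⟨hb', hd', hu⟩ : b = gcd b d * b' ∧ d = gcd b d * d' ∧ IsUnit (gcd b' d') := by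
    tauto
  have hg : gcd b d ≠ 0 := by
    intro h0; rw [h0, zero_mul] at hb'; exact hb hb'
  have hco : IsRelPrime b' d' := (gcd_isUnit_iff_isRelPrime).1 hu
  have h2 : a * b' ^ 2 = c * d' ^ 2 := by
    have : (gcd b d) ^ 2 * (a * b' ^ 2) = (gcd b d) ^ 2 * (c * d' ^ 2) := by
      calc _ = a * (gcd b d * b') ^ 2 := by ring
        _ = c * (gcd b d * d') ^ 2 := by rw [← hb', ← hd', h]
        _ = _ := by ring
    exact mul_left_cancel₀ (pow_ne_zero 2 hg) this
  have h3 : b' * b' ∣ c := by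
    have : b' ^ 2 ∣ c * d' ^ 2 := ⟨a, by rw [← h2]; ring⟩
    rw [← sq]
    exact (hco.pow (m := 2) (n := 2)).dvd_of_dvd_mul_right this
  have h4 := hc b' h3
  have : b ∣ gcd b d := by
    conv_lhs => rw [hb']
    exact (h4.mul_right_dvd).2 dvd_rfl
  exact this.trans (gcd_dvd_right b d)

open Polynomial in
theorem aux_exists {F : Type*} [Field F] (n : ℕ) : ∀ f : F[X], f.Monic → f.natDegree = n →
    ∃ a b : F[X], a.Monic ∧ Squarefree a ∧ b.Monic ∧ f = a * b ^ 2 := by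
  induction n using Nat.strong_induction_on with
  | _ n ih =>
    intro f hf hn
    by_cases hs : Squarefree f
    · exact ⟨f, 1, hf, hs, monic_one, by simp⟩
    · unfold Squarefree at hs
      push Not at hs
      obtain ⟨x, ⟨y, hxy⟩, hx⟩ := hs
      have hf0 := hf.ne_zero
      have hx0 : x ≠ 0 := by rintro rfl; simp at hxy; exact hf0 hxy
      have hxm : (x * C x.leadingCoeff⁻¹).Monic := monic_mul_leadingCoeff_inv hx0
      have hl : x.leadingCoeff ≠ 0 := leadingCoeff_ne_zero.2 hx0
      set z := x * C x.leadingCoeff⁻¹ with hz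
      have hxz : x = z * C x.leadingCoeff := by
        rw [hz, mul_assoc, ← C_mul, inv_mul_cancel₀ hl, C_1, mul_one]
      obtain ⟨w, hw⟩ : z ^ 2 ∣ f := by
        refine ⟨C x.leadingCoeff ^ 2 * y, ?_⟩
        rw [hxy]; nth_rewrite 1 2 [hxz]; ring
      have hwm : w.Monic := (hxm.pow 2).of_mul_monic_left (hw ▸ hf)
      have hzd : 0 < x.natDegree := by
        rw [Nat.pos_iff_ne_zero]
        intro h0
        exact hx (by
          rw [isUnit_iff_degree_eq_zero, degree_eq_natDegree hx0, h0]; rfl)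
      have hzd' : z.natDegree = x.natDegree := by
        rw [hz, natDegree_mul_C (inv_ne_zero hl)]
      have hdeg : w.natDegree < n := by
        have := (hxm.pow 2).natDegree_mul hwm
        rw [← hw, hxm.natDegree_pow] at this
        omega
      obtain ⟨a, b, ha, hsa, hb, hab⟩ := ih _ hdeg w hwm rfl
      exact ⟨a, z * b, ha, hsa, hxm.mul hb, by rw [hw, hab]; ring⟩

open Polynomial in
theorem aux_finite {F : Type*} [Field F] [Fintype F] (n : ℕ) :
    {p : F[X] | p.natDegree = n}.Finite := by
  refine Set.Finite.of_injOn (f := fun p : F[X] => fun i : Fin (n + 1) => p.coeff i)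
    (t := Set.univ) (fun _ _ => Set.mem_univ _) ?_ Set.finite_univ
  intro p hp r hr h
  ext i
  by_cases hi : i < n + 1
  · exact congrFun h ⟨i, hi⟩
  · rw [coeff_eq_zero_of_natDegree_lt, coeff_eq_zero_of_natDegree_lt] <;>
      simp only [Set.mem_ofPred_eq] at hp hr <;> omega

open Polynomial in
theorem aux_step {F : Type*} [Field F] (S : Set F) (n : ℕ) :
    {p : F[X] | p.Monic ∧ p.natDegree = n + 1 ∧ p.coeff 0 ∈ S}.ncard =
      {p : F[X] | p.Monic ∧ p.natDegree = n}.ncard * S.ncard := by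
  rw [← Set.ncard_prod]
  symm
  refine Set.ncard_congr (fun x _ => x.1 * X + C x.2) ?_ ?_ ?_
  · rintro ⟨g, c⟩ ⟨⟨hg, hgn⟩, hc⟩
    have hgX : (g * X).Monic := hg.mul monic_X
    have hd : (g * X).natDegree = n + 1 := by rw [hg.natDegree_mul monic_X]; simp_all
    have hlt : (C c : F[X]).degree < (g * X).degree := by
      rw [degree_eq_natDegree hgX.ne_zero, hd]
      exact lt_of_le_of_lt degree_C_le (by exact_mod_cast Nat.succ_pos n)
    refine ⟨hgX.add_of_left hlt, ?_, by simpa using hc⟩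
    simp [hd]
  · rintro ⟨g, c⟩ ⟨g', c'⟩ _ _ h
    have h2 := congrArg (fun p => coeff p 0) h
    simp at h2
    subst h2
    have h1 : g = g' := mul_right_cancel₀ X_ne_zero (add_right_cancel h)
    rw [h1]
  · rintro p ⟨hp, hn, hS⟩
    have hd : p.divX.natDegree = n := by rw [natDegree_divX_eq_natDegree_tsub_one]; omega
    refine ⟨(p.divX, p.coeff 0), ⟨⟨?_, hd⟩, hS⟩, divX_mul_X_add p⟩
    rw [Monic, leadingCoeff, hd, coeff_divX, ← hn]; exact hp

open Polynomial in
theorem aux_monic {F : Type*} [Field F] [Fintype F] (n : ℕ) :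
    {p : F[X] | p.Monic ∧ p.natDegree = n}.ncard = Fintype.card F ^ n := by
  induction n with
  | zero =>
    have : {p : F[X] | p.Monic ∧ p.natDegree = 0} = {1} := by
      ext p
      simp only [Set.mem_ofPred_eq, Set.mem_singleton_iff]
      exact ⟨fun h => h.1.natDegree_eq_zero.1 h.2, by rintro rfl; simp⟩
    rw [this]; simp
  | succ n ih =>
    have := aux_step (Set.univ : Set F) n
    simp only [Set.mem_univ, and_true] at this
    rw [this, ih, Set.ncard_univ, Nat.card_eq_fintype_card, pow_succ]

open Polynomial in
/-- monic of degree `n` with nonzero constant term -/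
noncomputable def MM (F : Type*) [Field F] (n : ℕ) : ℕ :=
  {p : F[X] | p.Monic ∧ p.natDegree = n ∧ p.coeff 0 ≠ 0}.ncard

open Polynomial in
/-- squarefree ones -/
noncomputable def AA (F : Type*) [Field F] (n : ℕ) : ℕ :=
  {p : F[X] | p.Monic ∧ Squarefree p ∧ p.natDegree = n ∧ p.coeff 0 ≠ 0}.ncard

open Polynomial in
theorem MM_zero (F : Type*) [Field F] : MM F 0 = 1 := by
  have : {p : F[X] | p.Monic ∧ p.natDegree = 0 ∧ p.coeff 0 ≠ 0} = {1} := by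
    ext p
    simp only [Set.mem_ofPred_eq, Set.mem_singleton_iff]
    exact ⟨fun h => h.1.natDegree_eq_zero.1 h.2.1, by rintro rfl; simp⟩
  rw [MM, this]; simp

theorem MM_succ (F : Type*) [Field F] [Fintype F] (n : ℕ) :
    (MM F (n + 1) : ℤ) = (Fintype.card F : ℤ) ^ n * ((Fintype.card F : ℤ) - 1) := by
  have h := aux_step ({0}ᶜ : Set F) n
  simp only [Set.mem_compl_iff, Set.mem_singleton_iff] at h
  have h2 : (({0}ᶜ : Set F).ncard : ℤ) = (Fintype.card F : ℤ) - 1 := by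
    have := Set.ncard_add_ncard_compl ({0} : Set F)
    rw [Set.ncard_singleton, Nat.card_eq_fintype_card] at this
    omega
  rw [MM, h, aux_monic]
  push_cast
  rw [h2]

open Polynomial in
theorem MM_eq_sum (F : Type*) [Field F] [Fintype F] (n : ℕ) :
    MM F n = ∑ k ∈ Finset.range (n / 2 + 1), AA F (n - 2 * k) * MM F k := by
  classical
  have hM : ∀ n, {p : F[X] | p.Monic ∧ p.natDegree = n ∧ p.coeff 0 ≠ 0}.Finite :=
    fun n => (aux_finite n).subset fun p hp => hp.2.1
  have hA : ∀ n, {p : F[X] | p.Monic ∧ Squarefree p ∧ p.natDegree = n ∧ p.coeff 0 ≠ 0}.Finite :=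
    fun n => (aux_finite n).subset fun p hp => hp.2.2.1
  have e1 : ∀ n, MM F n = (hM n).toFinset.card := fun n => Set.ncard_eq_toFinset_card _ (hM n)
  have e2 : ∀ n, AA F n = (hA n).toFinset.card := fun n => Set.ncard_eq_toFinset_card _ (hA n)
  simp only [e1, e2, ← Finset.card_product]
  rw [← Finset.card_sigma]
  symm
  refine Finset.card_bij (fun x _ => x.2.1 * x.2.2 ^ 2) ?_ ?_ ?_
  · rintro ⟨k, a, b⟩ h
    simp only [Finset.mem_sigma, Finset.mem_range, Finset.mem_product, Set.Finite.mem_toFinset,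
      Set.mem_ofPred_eq] at h ⊢
    obtain ⟨hk, ⟨ha, -, had, ha0⟩, hb, hbd, hb0⟩ := h
    refine ⟨ha.mul (hb.pow 2), ?_, ?_⟩
    · rw [ha.natDegree_mul (hb.pow 2), hb.natDegree_pow, had, hbd]; omega
    · rw [mul_coeff_zero, sq, mul_coeff_zero]
      exact mul_ne_zero ha0 (mul_ne_zero hb0 hb0)
  · rintro ⟨k, a, b⟩ h ⟨k', a', b'⟩ h' heq
    simp only [Finset.mem_sigma, Finset.mem_range, Finset.mem_product, Set.Finite.mem_toFinset,
      Set.mem_ofPred_eq] at h h' heq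
    obtain ⟨hk, ⟨ha, has, had, ha0⟩, hb, hbd, hb0⟩ := h
    obtain ⟨hk', ⟨ha', has', had', ha0'⟩, hb', hbd', hb0'⟩ := h'
    have hbb : b = b' := eq_of_monic_of_associated hb hb'
      (associated_of_dvd_dvd (aux_dvd hb.ne_zero has' heq) (aux_dvd hb'.ne_zero has heq.symm))
    subst hbb
    have haa : a = a' := mul_right_cancel₀ (pow_ne_zero 2 hb.ne_zero) heq
    subst haa
    have : k = k' := hbd.symm.trans hbd'
    subst this
    rfl
  · intro f hf
    simp only [Set.Finite.mem_toFinset, Set.mem_ofPred_eq] at hf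
    obtain ⟨hf, hfn, hf0⟩ := hf
    obtain ⟨a, b, ha, has, hb, rfl⟩ := aux_exists n f hf hfn
    rw [ha.natDegree_mul (hb.pow 2), hb.natDegree_pow] at hfn
    rw [mul_coeff_zero, sq, mul_coeff_zero] at hf0
    have h1 := left_ne_zero_of_mul hf0
    have h2 := left_ne_zero_of_mul (right_ne_zero_of_mul hf0)
    refine ⟨⟨b.natDegree, a, b⟩, ?_, rfl⟩
    simp only [Finset.mem_sigma, Finset.mem_range, Finset.mem_product, Set.Finite.mem_toFinset,
      Set.mem_ofPred_eq]
    refine ⟨by omega, ⟨ha, has, by omega, h1⟩, hb, trivial, h2⟩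

theorem AA_rec (F : Type*) [Field F] [Fintype F] (n : ℕ) :
    (AA F (n + 2) : ℤ) - AA F n = MM F (n + 2) - (Fintype.card F : ℤ) * MM F n := by
  have e1 := MM_eq_sum F (n + 2)
  have e2 := MM_eq_sum F n
  have hd : (n + 2) / 2 + 1 = (n / 2 + 1) + 1 := by omega
  rw [hd, Finset.sum_range_succ', Finset.sum_range_succ'] at e1
  rw [Finset.sum_range_succ'] at e2
  have hrec : (MM F 1 : ℤ) = Fintype.card F - 1 := by rw [MM_succ]; ring
  have h3 : ∀ k, (MM F (k + 1 + 1) : ℤ) = Fintype.card F * MM F (k + 1) := by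
    intro k; rw [MM_succ, MM_succ]; ring
  have h4 : ∀ k, n + 2 - 2 * (k + 1 + 1) = n - 2 * (k + 1) := by intro k; omega
  have h5 : ∑ k ∈ Finset.range (n / 2), (AA F (n + 2 - 2 * (k + 1 + 1)) : ℤ) * MM F (k + 1 + 1) =
      Fintype.card F * ∑ k ∈ Finset.range (n / 2), (AA F (n - 2 * (k + 1)) : ℤ) * MM F (k + 1) := by
    rw [Finset.mul_sum]
    refine Finset.sum_congr rfl fun k _ => ?_
    rw [h4, h3]; ring
  rw [e1, e2]
  push_cast
  rw [h5, hrec, MM_zero]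
  simp only [mul_zero, Nat.sub_zero]
  push_cast
  ring

/-- The number of monic squarefree polynomials of degree `n ≥ 1` over a finite field
with `q` elements and nonzero constant term equals
`(q^(n+1) - q^n + (-1)^(n+1) * (q-1)) / (q+1)`. -/
theorem regular_semisimple_classes_GL (q n : ℕ) (hn : 1 ≤ n)
    (F : Type*) [Field F] [Fintype F] (hq : Fintype.card F = q) :
    ({p : Polynomial F | p.Monic ∧ Squarefree p ∧ p.natDegree = n ∧ p.coeff 0 ≠ 0}.ncard : ℤ)
      * ((q : ℤ) + 1)
      = (q : ℤ) ^ (n + 1) - (q : ℤ) ^ n + (-1) ^ (n + 1) * ((q : ℤ) - 1) := by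
  change (AA F n : ℤ) * _ = _
  have h0 : (AA F 0 : ℤ) = 1 := by
    have := MM_eq_sum F 0
    simp [MM_zero] at this
    omega
  have h1 : (AA F 1 : ℤ) = q - 1 := by
    have h := MM_eq_sum F 1
    have h' := MM_succ F 0
    simp [MM_zero] at h
    rw [zero_add, h, hq] at h'
    rw [h']; ring
  induction n using Nat.strong_induction_on with
  | _ n ih =>
    match n, hn with
    | 1, _ => rw [h1]; ring
    | 2, _ =>
      have h := AA_rec F 0
      rw [h0, MM_succ, MM_zero, hq] at h
      have : (AA F 2 : ℤ) = (q : ℤ) ^ 2 - 2 * q + 1 := by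
        push_cast at h; norm_num at h; linarith
      rw [this]; ring
    | n + 3, _ =>
      have h := AA_rec F (n + 1)
      rw [MM_succ, MM_succ, hq] at h
      have h2 := ih (n + 1) (by omega) (by omega)
      have : (AA F (n + 3) : ℤ) = AA F (n + 1) + (q : ℤ) ^ (n + 2) * (q - 1)
          - q * (q ^ n * (q - 1)) := by
        have h' : n + 1 + 2 = n + 3 := rfl
        rw [h'] at h
        have h'' : n + 1 + 1 = n + 2 := rfl
        rw [h''] at h
        linarith
      rw [this, sub_mul, add_mul, h2]; ring
end

section
/- For q odd and n odd, the number of monic squarefree polynomials of degree n over F_q with constant term (-1)^n = -1 is (q^{n+1} - q^n + (q-1))/(q^2 - 1). -/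
namespace RSSL
open Polynomial

variable {F : Type*} [Field F]

lemma exists_sq_mul (n : ℕ) : ∀ f : F[X], f.Monic → f.natDegree = n →
    ∃ g h : F[X], g.Monic ∧ h.Monic ∧ Squarefree h ∧ g ^ 2 * h = f := by
  induction n using Nat.strong_induction_on with
  | _ n ih =>
    intro f hf hn
    by_cases hs : Squarefree f
    · exact ⟨1, f, monic_one, hf, hs, by simp⟩
    · unfold Squarefree at hs
      push Not at hs
      obtain ⟨x, ⟨y, hxy⟩, hu⟩ := hs
      have hx0 : x ≠ 0 := by
        rintro rfl
        apply hf.ne_zero; simp [hxy]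
      set a := x.leadingCoeff with ha
      have ha0 : a ≠ 0 := leadingCoeff_ne_zero.mpr hx0
      have hxm : (x * C a⁻¹).Monic := monic_mul_leadingCoeff_inv hx0
      have hf' : f = ((x * C a⁻¹) ^ 2) * (C (a ^ 2) * y) := by
        have : (C a⁻¹ * C a : F[X]) = 1 := by rw [← C_mul, inv_mul_cancel₀ ha0, C_1]
        rw [hxy, C_pow]
        linear_combination (-x * x * y * (C a⁻¹ * C a + 1)) * this
      have hy : (C (a ^ 2) * y).Monic := (hxm.pow 2).of_mul_monic_left (hf' ▸ hf)
      have hxd : (x * C a⁻¹).natDegree ≠ 0 := by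
        intro h0
        apply hu
        have h1 : x * C a⁻¹ = 1 := hxm.natDegree_eq_zero.mp h0
        exact IsUnit.of_mul_eq_one _ h1
      have hdeg := congrArg natDegree hf'
      rw [(hxm.pow 2).natDegree_mul hy, hxm.natDegree_pow] at hdeg
      obtain ⟨g, h, hg, hh, hsq, e⟩ := ih _ (by omega) _ hy rfl
      exact ⟨(x * C a⁻¹) * g, h, hxm.mul hg, hh, hsq, by rw [hf', ← e]; ring⟩

lemma dvd_of_sq_mul {g g' h h' : F[X]} (hg : g ≠ 0) (hs : Squarefree h')
    (e : g ^ 2 * h = g' ^ 2 * h') : g ∣ g' := by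
  classical
  obtain ⟨a, ha⟩ := EuclideanDomain.gcd_dvd_left g g'
  obtain ⟨b, hb⟩ := EuclideanDomain.gcd_dvd_right g g'
  set d := EuclideanDomain.gcd g g' with hd
  have hd0 : d ≠ 0 := by rintro h0; apply hg; rw [ha, h0, zero_mul]
  have hab : IsCoprime a b := by
    have := EuclideanDomain.gcd_eq_gcd_ab g g'
    rw [← hd] at this
    refine ⟨EuclideanDomain.gcdA g g', EuclideanDomain.gcdB g g', mul_left_cancel₀ hd0 ?_⟩
    linear_combination (-1 : F[X]) * this - EuclideanDomain.gcdA g g' * ha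
      - EuclideanDomain.gcdB g g' * hb
  have e2 : a ^ 2 * h = b ^ 2 * h' := by
    apply mul_left_cancel₀ (pow_ne_zero 2 hd0)
    rw [ha, hb] at e
    linear_combination e
  have h3 : a ^ 2 ∣ h' := (hab.pow (m := 2) (n := 2)).dvd_of_dvd_mul_left ⟨h, e2.symm⟩
  have hu : IsUnit a := hs a (by rwa [← sq])
  rw [ha]
  rw [hu.mul_right_dvd]
  exact ⟨b, hb⟩

lemma unique_sq_mul {g g' h h' : F[X]} (hg : g.Monic) (hg' : g'.Monic)
    (hs : Squarefree h) (hs' : Squarefree h')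
    (e : g ^ 2 * h = g' ^ 2 * h') : g = g' ∧ h = h' := by
  have h1 := dvd_of_sq_mul hg.ne_zero hs' e
  have h2 := dvd_of_sq_mul hg'.ne_zero hs e.symm
  have : g = g' := eq_of_monic_of_associated hg hg' (associated_of_dvd_dvd h1 h2)
  subst this
  exact ⟨rfl, mul_left_cancel₀ (pow_ne_zero 2 hg.ne_zero) e⟩

def P (F : Type*) [Field F] (n : ℕ) (c : F) : Set F[X] :=
  {p | p.Monic ∧ p.natDegree = n ∧ p.coeff 0 = c}

def S (F : Type*) [Field F] (n : ℕ) (c : F) : Set F[X] :=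
  {p | p.Monic ∧ Squarefree p ∧ p.natDegree = n ∧ p.coeff 0 = c}

lemma monic_finite_card [Fintype F] (n : ℕ) :
    {p : F[X] | p.Monic ∧ p.natDegree = n}.Finite ∧
    {p : F[X] | p.Monic ∧ p.natDegree = n}.ncard = Fintype.card F ^ n := by
  have e : {p : F[X] | p.Monic ∧ p.natDegree = n} ≃ (Fin n → F) :=
    (monicEquivDegreeLT n).trans (degreeLTEquiv F n).toEquiv
  refine ⟨Finite.of_equiv _ e.symm, ?_⟩
  rw [← Nat.card_coe_set_eq, Nat.card_congr e]
  simp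

lemma P_finite [Fintype F] (n : ℕ) (c : F) : (P F n c).Finite :=
  (monic_finite_card n).1.subset fun _ hp => ⟨hp.1, hp.2.1⟩

lemma S_finite [Fintype F] (n : ℕ) (c : F) : (S F n c).Finite :=
  (monic_finite_card n).1.subset fun _ hp => ⟨hp.1, hp.2.2.1⟩

lemma P_succ [Fintype F] (n : ℕ) (c : F) : (P F (n + 1) c).ncard = Fintype.card F ^ n := by
  rw [← (monic_finite_card n).2]
  symm
  refine Set.ncard_congr (fun g _ => X * g + C c) ?_ ?_ ?_
  · rintro g ⟨hg, hd⟩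
    have hm : (X * g).Monic := monic_X.mul hg
    have hdd : (X * g).natDegree = n + 1 := by
      rw [monic_X.natDegree_mul hg, natDegree_X, hd, add_comm]
    have hlt : (C c).degree < (X * g).degree := by
      rw [degree_eq_natDegree hm.ne_zero, hdd]
      exact lt_of_le_of_lt degree_C_le (by exact_mod_cast Nat.succ_pos n)
    refine ⟨hm.add_of_left hlt, ?_, by simp⟩
    rw [natDegree_add_C, hdd]
  · intro g g' _ _ h
    exact mul_left_cancel₀ X_ne_zero (add_right_cancel h)
  · rintro f ⟨hf, hd, hc⟩
    have hX : X * f.divX + C c = f := by rw [← hc]; exact X_mul_divX_add f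
    refine ⟨f.divX, ⟨?_, ?_⟩, hX⟩
    · rw [Monic, leadingCoeff, natDegree_divX_eq_natDegree_tsub_one, coeff_divX, hd]
      simpa [Monic, leadingCoeff, hd] using hf
    · rw [natDegree_divX_eq_natDegree_tsub_one, hd]; rfl

lemma P_zero_one : (P F 0 1) = {1} := by
  ext p
  constructor
  · rintro ⟨h1, h2, _⟩
    exact h1.natDegree_eq_zero.mp h2
  · rintro rfl
    exact ⟨monic_one, by simp, by simp⟩

lemma P_zero_ne {c : F} (hc : c ≠ 1) : (P F 0 c) = ∅ := by
  ext p
  simp only [Set.mem_empty_iff_false, iff_false]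
  rintro ⟨h1, h2, h3⟩
  rw [h1.natDegree_eq_zero.mp h2] at h3
  exact hc (by simpa using h3.symm)

lemma card_decomp [Fintype F] [DecidableEq F] (r : ℕ) (c : Fˣ) :
    (P F (2 * r + 1) (c : F)).ncard = ∑ k ∈ Finset.range (r + 1), ∑ d : Fˣ,
      (P F k (d : F)).ncard * (S F (2 * (r - k) + 1) ((c * (d⁻¹) ^ 2 : Fˣ) : F)).ncard := by
  have h1 : ∀ k (d : Fˣ), (P F k (d : F)).ncard *
      (S F (2 * (r - k) + 1) ((c * (d⁻¹) ^ 2 : Fˣ) : F)).ncard =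
      ((P_finite k (d : F)).toFinset ×ˢ
        (S_finite (2 * (r - k) + 1) ((c * (d⁻¹) ^ 2 : Fˣ) : F)).toFinset).card := by
    intro k d
    rw [Finset.card_product, Set.ncard_eq_toFinset_card _ (P_finite _ _),
      Set.ncard_eq_toFinset_card _ (S_finite _ _)]
  simp_rw [h1]
  rw [← Finset.sum_product', ← Finset.card_sigma, Set.ncard_eq_toFinset_card _ (P_finite _ _)]
  symm
  refine Finset.card_bij (fun x _ => x.2.1 ^ 2 * x.2.2) ?_ ?_ ?_
  · rintro ⟨⟨k, d⟩, ⟨g, h⟩⟩ hx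
    simp only [Finset.mem_sigma, Finset.mem_product, Finset.mem_range, Finset.mem_univ,
      Set.Finite.mem_toFinset, and_true, P, S, Set.mem_ofPred_eq] at hx ⊢
    obtain ⟨hk, ⟨g1, g2, g3⟩, h1, h2, h3, h4⟩ := hx
    refine ⟨(g1.pow 2).mul h1, ?_, ?_⟩
    · rw [(g1.pow 2).natDegree_mul h1, g1.natDegree_pow, g2, h3]; omega
    · rw [mul_coeff_zero, sq, mul_coeff_zero, g3, h4]
      norm_cast
      rw [← sq, mul_left_comm, ← mul_pow]
      simp
  · rintro ⟨⟨k, d⟩, ⟨g, h⟩⟩ hx ⟨⟨k', d'⟩, ⟨g', h'⟩⟩ hx' e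
    simp only [Finset.mem_sigma, Finset.mem_product, Finset.mem_range, Finset.mem_univ,
      Set.Finite.mem_toFinset, and_true, P, S, Set.mem_ofPred_eq] at hx hx' e
    obtain ⟨hk, ⟨g1, g2, g3⟩, h1, h2, h3, h4⟩ := hx
    obtain ⟨hk', ⟨g1', g2', g3'⟩, h1', h2', h3', h4'⟩ := hx'
    obtain ⟨rfl, rfl⟩ := unique_sq_mul g1 g1' h2 h2' e
    have : d = d' := Units.ext (g3.symm.trans g3')
    subst this
    have : k = k' := g2.symm.trans g2'
    subst this
    rfl
  · intro f hf
    simp only [Set.Finite.mem_toFinset, P, Set.mem_ofPred_eq] at hf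
    obtain ⟨f1, f2, f3⟩ := hf
    obtain ⟨g, h, hg, hh, hs, e⟩ := exists_sq_mul _ f f1 rfl
    have hd := congrArg natDegree e
    rw [(hg.pow 2).natDegree_mul hh, hg.natDegree_pow, f2] at hd
    have hc := congrArg (fun p => coeff p 0) e
    simp only [mul_coeff_zero, sq, f3] at hc
    have hg0 : g.coeff 0 ≠ 0 := by
      intro h0
      apply c.ne_zero
      rw [← hc, h0]; simp
    refine ⟨⟨⟨g.natDegree, Units.mk0 _ hg0⟩, ⟨g, h⟩⟩, ?_, e⟩
    simp only [Finset.mem_sigma, Finset.mem_product, Finset.mem_range, Finset.mem_univ,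
      Set.Finite.mem_toFinset, and_true, P, S, Set.mem_ofPred_eq]
    refine ⟨by omega, ⟨hg, trivial, rfl⟩, hh, hs, by omega, ?_⟩
    push_cast
    rw [← hc, Units.val_mk0]
    field_simp

lemma geom (q : ℤ) (r : ℕ) :
    (q - 1) * ∑ k ∈ Finset.range r, q ^ k * (q ^ (2 * (r - (k + 1)) + 1 + 1)
      - q ^ (2 * (r - (k + 1)) + 1) + (q - 1)) = (q - 1) * (q ^ (2 * r) - 1) := by
  congr 1
  induction r with
  | zero => simp
  | succ r ih =>
    rw [Finset.sum_range_succ']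
    have : ∀ k, r + 1 - (k + 1 + 1) = r - (k + 1) := by intro k; omega
    simp only [this, pow_succ q, mul_assoc, mul_left_comm _ q]
    rw [← Finset.mul_sum]
    simp only [pow_succ q, mul_assoc, mul_left_comm _ q] at ih
    rw [ih]
    simp
    ring

lemma main [Fintype F] (r : ℕ) : ∀ c : Fˣ,
    ((S F (2 * r + 1) (c : F)).ncard : ℤ) * ((Fintype.card F : ℤ) ^ 2 - 1)
      = (Fintype.card F : ℤ) ^ (2 * r + 1 + 1) - (Fintype.card F : ℤ) ^ (2 * r + 1)
        + ((Fintype.card F : ℤ) - 1) := by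
  classical
  induction r using Nat.strong_induction_on with
  | _ r ih =>
    intro c
    have h := card_decomp r c
    rw [Finset.sum_range_succ', P_succ] at h
    have h0 : ∑ d : Fˣ, (P F 0 (d : F)).ncard *
        (S F (2 * (r - 0) + 1) ((c * (d⁻¹) ^ 2 : Fˣ) : F)).ncard
        = (S F (2 * r + 1) (c : F)).ncard := by
      rw [Finset.sum_eq_single (1 : Fˣ)]
      · simp [P_zero_one]
      · intro d _ hd
        rw [P_zero_ne (by simpa using hd)]; simp
      · simp
    rw [h0] at h
    set q : ℤ := (Fintype.card F : ℤ) with hq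
    have h' := congrArg (fun x : ℕ => (x : ℤ) * (q ^ 2 - 1)) h
    simp only [P_succ] at h'
    push_cast at h'
    rw [← hq, add_mul, Finset.sum_mul] at h'
    have hcard : ((Fintype.card Fˣ : ℕ) : ℤ) = q - 1 := by
      rw [Fintype.card_units, Nat.cast_sub Fintype.card_pos]; simp [hq]
    have h2 : ∀ k ∈ Finset.range r, (∑ d : Fˣ, q ^ k *
        ((S F (2 * (r - (k + 1)) + 1) ((c : F) * ((d : F)⁻¹) ^ 2)).ncard : ℤ)) * (q ^ 2 - 1)
        = (q - 1) * (q ^ k * (q ^ (2 * (r - (k + 1)) + 1 + 1)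
      - q ^ (2 * (r - (k + 1)) + 1) + (q - 1))) := by
      intro k hk
      rw [Finset.mem_range] at hk
      rw [Finset.sum_mul]
      have : ∀ d : Fˣ, q ^ k *
        ((S F (2 * (r - (k + 1)) + 1) ((c : F) * ((d : F)⁻¹) ^ 2)).ncard : ℤ) * (q ^ 2 - 1)
         = q ^ k * (q ^ (2 * (r - (k + 1)) + 1 + 1)
      - q ^ (2 * (r - (k + 1)) + 1) + (q - 1)) := by
        intro d
        have := ih (r - (k + 1)) (by omega) (c * (d⁻¹) ^ 2)
        push_cast at this
        rw [mul_assoc, this]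
      rw [Finset.sum_congr rfl (fun d _ => this d), Finset.sum_const, Finset.card_univ,
        nsmul_eq_mul, hcard]
    rw [Finset.sum_congr rfl h2, ← Finset.mul_sum, geom] at h'
    linear_combination (-1 : ℤ) * h'

end RSSL


/-- For `q` odd and `n` odd, the number of monic squarefree polynomials of degree `n`
over `F_q` with constant term `(-1)^n = -1` equals `(q^(n+1) - q^n + (q-1))/(q² - 1)`. -/
theorem regular_semisimple_classes_SL_odd_char_odd_n (q n : ℕ) (hn : Odd n)
    (hq2 : Odd q) (F : Type*) [Field F] [Fintype F] (hq : Fintype.card F = q) :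
    ({p : Polynomial F | p.Monic ∧ Squarefree p ∧ p.natDegree = n ∧ p.coeff 0 = -1}.ncard : ℤ)
      * ((q : ℤ) ^ 2 - 1)
      = (q : ℤ) ^ (n + 1) - (q : ℤ) ^ n + ((q : ℤ) - 1) := by
  obtain ⟨r, rfl⟩ := hn
  subst hq
  have := RSSL.main (F := F) r (-1)
  simpa [RSSL.S] using this
end

section
/- For q even (a power of 2) and n ≥ 1, the number of monic squarefree *-self-conjugate polynomials of degree 2n over F_q with constant term 1 (equivalently, regular semisimple conjugacy classes of Sp(2n,q)) equals ((q-1)/(q+1))(q^n + (-1)^{n-1}), which is the same as the number of regular semisimple classes of GL(n,q). -/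
section RSaux
open Polynomial

lemma RS_exists_decomp {F : Type*} [Field F] : ∀ (n : ℕ) (f : F[X]), f.Monic → f.natDegree = n →
    ∃ a b : F[X], Squarefree a ∧ a.Monic ∧ b.Monic ∧ f = a * b ^ 2 := by
  intro n
  induction n using Nat.strong_induction_on with
  | _ n ih =>
    intro f hf hn
    by_cases hs : Squarefree f
    · exact ⟨f, 1, hs, hf, monic_one, by simp⟩
    · unfold Squarefree at hs
      push Not at hs
      obtain ⟨x, ⟨g, hg⟩, hx⟩ := hs
      have hf0 : f ≠ 0 := hf.ne_zero
      have hx0 : x ≠ 0 := by rintro rfl; simp at hg; exact hf0 hg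
      have hg0 : g ≠ 0 := by rintro rfl; simp at hg; exact hf0 hg
      set y := x * C x.leadingCoeff⁻¹ with hy
      have hym : y.Monic := monic_mul_leadingCoeff_inv hx0
      have hlx : x.leadingCoeff ≠ 0 := leadingCoeff_ne_zero.mpr hx0
      obtain ⟨h, hh⟩ : ∃ h, f = y * y * h := by
        refine ⟨C (x.leadingCoeff) * C (x.leadingCoeff) * g, ?_⟩
        have : C x.leadingCoeff⁻¹ * C x.leadingCoeff = 1 := by
          rw [← C_mul, inv_mul_cancel₀ hlx, C_1]
        rw [hy, hg]
        linear_combination (-(x * x * g) * (1 + C x.leadingCoeff⁻¹ * C x.leadingCoeff)) * this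
      have hhm : h.Monic := by
        have : (y * y * h).Monic := hh ▸ hf
        exact (hym.mul hym).of_mul_monic_left this
      have hyd : 0 < y.natDegree := by
        rw [hy, natDegree_mul_leadingCoeff_inv x hx0]
        exact Polynomial.natDegree_pos_iff_degree_pos.mpr (degree_pos_of_ne_zero_of_nonunit hx0 hx)
      have hd : f.natDegree = y.natDegree + y.natDegree + h.natDegree := by
        rw [hh, (hym.mul hym).natDegree_mul hhm, hym.natDegree_mul hym]
      obtain ⟨a, b, ha, ham, hb, hab⟩ := ih h.natDegree (by omega) h hhm rfl
      exact ⟨a, y * b, ha, ham, hym.mul hb, by rw [hh, hab]; ring⟩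

lemma RS_dvd {F : Type*} [Field F] {a b a' b' : F[X]} (ha' : Squarefree a')
    (hb' : b'.Monic) (h : a * b ^ 2 = a' * b' ^ 2) : b ∣ b' := by
  classical
  have hne : b' ≠ 0 := hb'.ne_zero
  have hg : EuclideanDomain.gcd b b' ≠ 0 := fun h0 => hne (EuclideanDomain.gcd_eq_zero_iff.mp h0).2
  obtain ⟨c, hc⟩ := EuclideanDomain.gcd_dvd_left b b'
  obtain ⟨c', hc'⟩ := EuclideanDomain.gcd_dvd_right b b'
  obtain ⟨u, v, huv⟩ : ∃ u v, EuclideanDomain.gcd b b' = b * u + b' * v :=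
    ⟨_, _, EuclideanDomain.gcd_eq_gcd_ab b b'⟩
  generalize EuclideanDomain.gcd b b' = g at *
  have hco : IsCoprime c c' := by
    refine ⟨u, v, mul_left_cancel₀ hg ?_⟩
    calc g * (u * c + v * c') = (g * c) * u + (g * c') * v := by ring
      _ = g * 1 := by rw [← hc, ← hc', ← huv, mul_one]
  have h2 : a * c ^ 2 = a' * c' ^ 2 := by
    apply mul_left_cancel₀ (pow_ne_zero 2 hg)
    calc g ^ 2 * (a * c ^ 2) = a * (g * c) ^ 2 := by ring
      _ = a' * (g * c') ^ 2 := by rw [← hc, ← hc', h]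
      _ = _ := by ring
  have hd : c ^ 2 ∣ a' := (hco.pow (m := 2) (n := 2)).dvd_of_dvd_mul_right ⟨a, by rw [← h2]; ring⟩
  have hu : IsUnit c := ha' c (by rwa [← sq])
  rw [hc, hc']
  exact mul_dvd_mul_left g hu.dvd

lemma RS_unique {F : Type*} [Field F] {a b a' b' : F[X]} (ha : Squarefree a) (ha' : Squarefree a')
    (hb : b.Monic) (hb' : b'.Monic) (h : a * b ^ 2 = a' * b' ^ 2) : a = a' ∧ b = b' := by
  have hbb : b = b' := eq_of_monic_of_associated hb hb'
    (associated_of_dvd_dvd (RS_dvd ha' hb' h) (RS_dvd ha hb h.symm))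
  subst hbb
  exact ⟨mul_right_cancel₀ (pow_ne_zero 2 hb.ne_zero) h, rfl⟩

lemma RS_card_monic (F : Type*) [Field F] [Fintype F] (n : ℕ) :
    {p : F[X] | p.Monic ∧ p.natDegree = n}.ncard = Fintype.card F ^ n := by
  have := Nat.card_congr ((monicEquivDegreeLT (R := F) n).trans (degreeLTEquiv F n).toEquiv)
  rw [← Nat.card_coe_set_eq]
  exact this.trans (by simp)

lemma RS_finite_monic (F : Type*) [Field F] [Fintype F] (n : ℕ) :
    {p : F[X] | p.Monic ∧ p.natDegree = n}.Finite := by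
  apply Set.finite_of_ncard_ne_zero
  rw [RS_card_monic]
  exact pow_ne_zero _ Fintype.card_ne_zero

lemma RS_shift {F : Type*} [Field F] {b : F[X]} (hb : b.Monic) (c : F) :
    (b * X + C c).Monic ∧ (b * X + C c).natDegree = b.natDegree + 1 := by
  have h1 : (b * X).Monic := hb.mul monic_X
  have h2 : (b * X).natDegree = b.natDegree + 1 := by
    rw [hb.natDegree_mul monic_X, natDegree_X]
  constructor
  · apply h1.add_of_left
    refine lt_of_le_of_lt degree_C_le ?_
    rw [← natDegree_pos_iff_degree_pos]; omega
  · rw [natDegree_add_C, h2]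

lemma RS_card_sqfree (F : Type*) [Field F] [Fintype F] (n : ℕ) :
    {p : F[X] | p.Monic ∧ p.natDegree = n + 2 ∧ Squarefree p}.ncard + Fintype.card F ^ (n + 1)
      = Fintype.card F ^ (n + 2) := by
  classical
  have hdec : ∀ f : F[X], ∃ ab : F[X] × F[X], f.Monic →
      Squarefree ab.1 ∧ ab.1.Monic ∧ ab.2.Monic ∧ f = ab.1 * ab.2 ^ 2 := by
    intro f
    by_cases hf : f.Monic
    · obtain ⟨a, b, h⟩ := RS_exists_decomp _ f hf rfl
      exact ⟨(a, b), fun _ => h⟩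
    · exact ⟨(0, 0), fun h => absurd h hf⟩
  choose D hD using hdec
  let T : Set (F × F[X]) := Set.univ ×ˢ {p : F[X] | p.Monic ∧ p.natDegree = n}
  let Ψ : F × F[X] → F[X] := fun x => (D x.2).1 * ((D x.2).2 * X + C x.1) ^ 2
  have himg : Ψ '' T = {p : F[X] | p.Monic ∧ p.natDegree = n + 2} \
      {p : F[X] | p.Monic ∧ p.natDegree = n + 2 ∧ Squarefree p} := by
    ext p
    constructor
    · rintro ⟨⟨c, f⟩, ⟨-, hf, hfn⟩, rfl⟩
      obtain ⟨h1, h2, h3, h4⟩ := hD f hf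
      obtain ⟨h5, h6⟩ := RS_shift h3 c
      have hdf : f.natDegree = (D f).1.natDegree + 2 * (D f).2.natDegree := by
        conv_lhs => rw [h4]
        rw [h2.natDegree_mul (h3.pow 2), h3.natDegree_pow]
      refine ⟨⟨h2.mul (h5.pow 2), ?_⟩, ?_⟩
      · change ((D f).1 * ((D f).2 * X + C c) ^ 2).natDegree = _
        rw [h2.natDegree_mul (h5.pow 2), h5.natDegree_pow, h6]
        simp only at hfn
        omega
      · rintro ⟨-, -, hs⟩
        have := hs ((D f).2 * X + C c) ⟨(D f).1, by simp only [Ψ]; ring⟩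
        rw [h5.isUnit_iff] at this
        rw [this] at h6
        simp at h6
    · rintro ⟨⟨hp, hpn⟩, hns⟩
      obtain ⟨a, b, ha, ham, hb, hab⟩ := RS_exists_decomp _ p hp rfl
      have hbd : b.natDegree ≠ 0 := by
        intro h0
        have : b = 1 := hb.natDegree_eq_zero.mp h0
        subst this
        apply hns
        refine ⟨hp, hpn, ?_⟩
        rw [hab]; simpa using ha
      have hbe : b.divX * X + C (b.coeff 0) = b := divX_mul_X_add b
      have hbm : b.divX.Monic := by
        unfold Monic leadingCoeff
        rw [natDegree_divX_eq_natDegree_tsub_one, coeff_divX, Nat.sub_add_cancel (by omega)]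
        exact hb
      have hfm : (a * b.divX ^ 2).Monic := ham.mul (hbm.pow 2)
      refine ⟨(b.coeff 0, a * b.divX ^ 2), ⟨trivial, hfm, ?_⟩, ?_⟩
      · simp only
        rw [hab, ham.natDegree_mul (hb.pow 2), hb.natDegree_pow] at hpn
        rw [ham.natDegree_mul (hbm.pow 2), hbm.natDegree_pow, natDegree_divX_eq_natDegree_tsub_one]
        omega
      · obtain ⟨h1, h2, h3, h4⟩ := hD _ hfm
        obtain ⟨e1, e2⟩ := RS_unique h1 ha h3 hbm h4.symm
        simp only [Ψ]
        rw [e1, e2, hbe, ← hab]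
  have hinj : Set.InjOn Ψ T := by
    rintro ⟨c, f⟩ ⟨-, hf, hfn⟩ ⟨c', f'⟩ ⟨-, hf', hfn'⟩ he
    obtain ⟨h1, h2, h3, h4⟩ := hD f hf
    obtain ⟨h1', h2', h3', h4'⟩ := hD f' hf'
    obtain ⟨e1, e2⟩ := RS_unique h1 h1' (RS_shift h3 c).1 (RS_shift h3' c').1 he
    have ec : c = c' := by simpa using congrArg (fun p => coeff p 0) e2
    subst ec
    have e3 : (D f).2 = (D f').2 := mul_right_cancel₀ X_ne_zero (add_right_cancel e2)
    rw [Prod.mk.injEq]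
    refine ⟨rfl, ?_⟩
    rw [h4, h4', e1, e3]
  have hcT : T.ncard = Fintype.card F ^ (n + 1) := by
    rw [Set.ncard_prod, RS_card_monic, Set.ncard_univ, Nat.card_eq_fintype_card, pow_succ, mul_comm]
  rw [← hcT, ← hinj.ncard_image, himg, add_comm, ← RS_card_monic F (n + 2)]
  exact Set.ncard_sdiff_add_ncard_of_subset (fun p hp => ⟨hp.1, hp.2.1⟩) (RS_finite_monic F _)

lemma RS_step (F : Type*) [Field F] [Fintype F] (n : ℕ) :
    {p : F[X] | p.Monic ∧ Squarefree p ∧ p.natDegree = n + 1 ∧ p.coeff 0 ≠ 0}.ncard +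
    {p : F[X] | p.Monic ∧ Squarefree p ∧ p.natDegree = n ∧ p.coeff 0 ≠ 0}.ncard =
    {p : F[X] | p.Monic ∧ p.natDegree = n + 1 ∧ Squarefree p}.ncard := by
  have hfin : {p : F[X] | p.Monic ∧ p.natDegree = n + 1 ∧ Squarefree p}.Finite :=
    (RS_finite_monic F (n + 1)).subset fun p hp => ⟨hp.1, hp.2.1⟩
  rw [← Set.ncard_image_of_injective (s := {p : F[X] | p.Monic ∧ Squarefree p ∧ p.natDegree = n ∧ p.coeff 0 ≠ 0})
    (mul_left_injective₀ (X_ne_zero (R := F)))]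
  rw [add_comm]
  have hsub : {p : F[X] | p.Monic ∧ Squarefree p ∧ p.natDegree = n + 1 ∧ p.coeff 0 ≠ 0} ⊆
      {p : F[X] | p.Monic ∧ p.natDegree = n + 1 ∧ Squarefree p} :=
    fun p hp => ⟨hp.1, hp.2.2.1, hp.2.1⟩
  convert Set.ncard_sdiff_add_ncard_of_subset hsub hfin using 3
  ext p
  constructor
  · rintro ⟨g, ⟨hg, hs, hd, h0⟩, rfl⟩
    refine ⟨⟨hg.mul monic_X, ?_, ?_⟩, ?_⟩
    · simp only
      rw [hg.natDegree_mul monic_X, natDegree_X, hd]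
    · simp only
      refine squarefree_mul_iff.mpr ⟨?_, hs, irreducible_X.squarefree⟩
      apply IsRelPrime.symm
      rw [irreducible_X.isRelPrime_iff_not_dvd, X_dvd_iff]
      exact h0
    · rintro ⟨-, -, -, h⟩
      simp at h
  · rintro ⟨⟨hm, hd, hs⟩, hn⟩
    have h0 : p.coeff 0 = 0 := by
      by_contra h
      exact hn ⟨hm, hs, hd, h⟩
    obtain ⟨g, rfl⟩ := X_dvd_iff.mpr h0
    have hg : g.Monic := monic_X.of_mul_monic_left hm
    rw [monic_X.natDegree_mul hg, natDegree_X] at hd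
    refine ⟨g, ⟨hg, hs.of_mul_right, by omega, ?_⟩, mul_comm _ _⟩
    intro hg0
    obtain ⟨k, rfl⟩ := X_dvd_iff.mpr hg0
    exact not_isUnit_X (hs X ⟨k, by ring⟩)

lemma RS_count (F : Type*) [Field F] [Fintype F] (n : ℕ) :
    ({p : F[X] | p.Monic ∧ Squarefree p ∧ p.natDegree = n + 1 ∧ p.coeff 0 ≠ 0}.ncard : ℤ) *
      ((Fintype.card F : ℤ) + 1) =
      ((Fintype.card F : ℤ) - 1) * ((Fintype.card F : ℤ) ^ (n + 1) + (-1) ^ n) := by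
  induction n with
  | zero =>
    have h := RS_step F 0
    have h1 : {p : F[X] | p.Monic ∧ Squarefree p ∧ p.natDegree = 0 ∧ p.coeff 0 ≠ 0} = {1} := by
      ext p
      constructor
      · rintro ⟨hm, -, hd, -⟩
        exact hm.natDegree_eq_zero.mp hd
      · rintro rfl
        exact ⟨monic_one, squarefree_one, natDegree_one, by simp⟩
    have h2 : {p : F[X] | p.Monic ∧ p.natDegree = 0 + 1 ∧ Squarefree p} =
        {p : F[X] | p.Monic ∧ p.natDegree = 1} := by
      ext p
      constructor
      · rintro ⟨hm, hd, -⟩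
        exact ⟨hm, hd⟩
      · rintro ⟨hm, hd⟩
        refine ⟨hm, hd, (irreducible_of_degree_eq_one ?_).squarefree⟩
        rw [degree_eq_natDegree hm.ne_zero, hd]; rfl
    rw [h1, h2, RS_card_monic, Set.ncard_singleton] at h
    replace h := congrArg (Nat.cast : ℕ → ℤ) h
    push_cast at h
    simp only [zero_add] at h ⊢
    linear_combination ((Fintype.card F : ℤ) + 1) * h
  | succ n ih =>
    have h := RS_step F (n + 1)
    have h2 := RS_card_sqfree F n
    rw [← h] at h2
    replace h2 := congrArg (Nat.cast : ℕ → ℤ) h2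
    push_cast at h2
    linear_combination ((Fintype.card F : ℤ) + 1) * h2 - ih

noncomputable def RSPhi {F : Type*} [Field F] (n : ℕ) (g : F[X]) : F[X] :=
  ∑ i ∈ Finset.range (n + 1), C (g.coeff i) * ((X ^ 2 + 1) ^ i * X ^ (n - i))

section
variable {F : Type*} [Field F]

lemma RS_eq_of_aeval {p r : F[X]} (h : ∀ x : AlgebraicClosure F, x ≠ 0 → aeval x p = aeval x r) :
    p = r := by
  apply map_injective (algebraMap F (AlgebraicClosure F)) (algebraMap F (AlgebraicClosure F)).injective
  apply eq_of_infinite_eval_eq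
  refine (Set.finite_singleton (0 : AlgebraicClosure F)).infinite_compl.mono ?_
  intro x hx
  simpa [eval_map_algebraMap] using h x hx

lemma RS_aeval_Phi {n : ℕ} {g : F[X]} (hg : g.natDegree ≤ n) {x : AlgebraicClosure F} (hx : x ≠ 0) :
    aeval x (RSPhi n g) = x ^ n * aeval (x + x⁻¹) g := by
  rw [aeval_eq_sum_range' (Nat.lt_succ_of_le hg), RSPhi, map_sum, Finset.mul_sum]
  apply Finset.sum_congr rfl
  intro i hi
  have hi : i ≤ n := by simpa [Nat.lt_succ_iff] using hi
  have h1 : x ^ n = x ^ i * x ^ (n - i) := by rw [← pow_add]; congr 1; omega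
  have h2 : x ^ 2 + 1 = x * (x + x⁻¹) := by field_simp
  simp only [map_mul, map_pow, map_add, aeval_X, aeval_C, map_one, Algebra.smul_def]
  rw [h1, h2, mul_pow]; ring

lemma RS_aeval_Phi_deriv {n : ℕ} {g : F[X]} (hg : g.natDegree ≤ n) {x : AlgebraicClosure F}
    (hx : x ≠ 0) : x * aeval x (derivative (RSPhi n g)) = n * aeval x (RSPhi n g) +
      x ^ n * (x - x⁻¹) * aeval (x + x⁻¹) (derivative g) := by
  have hd : aeval (x + x⁻¹) (derivative g) = ∑ i ∈ Finset.range (n + 1),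
      algebraMap F (AlgebraicClosure F) (g.coeff i) * i * (x + x⁻¹) ^ (i - 1) := by
    rw [← eval_map_algebraMap, ← derivative_map, derivative_eval, sum_over_range' _ _ (n + 1)]
    · simp
    · rw [natDegree_map]; omega
    · simp
  rw [hd, RSPhi]
  simp only [derivative_sum, map_sum, Finset.mul_sum]
  rw [← Finset.sum_add_distrib]
  apply Finset.sum_congr rfl
  intro i hi
  have hi : i ≤ n := by simpa [Nat.lt_succ_iff] using hi
  have h2 : x ^ 2 + 1 = x * (x + x⁻¹) := by field_simp
  obtain ⟨k, rfl⟩ := Nat.exists_eq_add_of_le hi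
  simp only [derivative_mul, derivative_C, derivative_pow, derivative_add, derivative_X,
    derivative_one, map_mul, map_pow, map_add, aeval_X, aeval_C, map_one, map_natCast, map_zero,
    Nat.add_sub_cancel_left]
  rw [h2]
  obtain ⟨w, hw⟩ : ∃ w, w = x + x⁻¹ := ⟨_, rfl⟩
  have hinv : x⁻¹ = w - x := by rw [hw]; ring
  rw [← hw, hinv]
  rcases i with _ | i <;> rcases k with _ | k <;> simp <;> ring

lemma RS_natDegree_Phi (n : ℕ) (g : F[X]) : (RSPhi n g).natDegree ≤ 2 * n := by
  apply natDegree_sum_le_of_forall_le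
  intro i hi
  have hi : i ≤ n := by simpa [Nat.lt_succ_iff] using hi
  refine (natDegree_C_mul_le _ _).trans ?_
  have : ((X ^ 2 + 1 : F[X]) ^ i * X ^ (n - i)).natDegree ≤ i * 2 + (n - i) := by
    compute_degree
  omega

lemma RS_reflect_Phi {n : ℕ} {g : F[X]} (hg : g.natDegree ≤ n) :
    reflect (2 * n) (RSPhi n g) = RSPhi n g := by
  apply RS_eq_of_aeval
  intro x hx
  letI : Invertible x⁻¹ := invertibleOfNonzero (inv_ne_zero hx)
  have h := eval₂_reflect_mul_pow (algebraMap F (AlgebraicClosure F)) x⁻¹ (2 * n) (RSPhi n g)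
    (RS_natDegree_Phi n g)
  simp only [invOf_eq_inv, inv_inv, ← aeval_def] at h
  rw [RS_aeval_Phi hg (inv_ne_zero hx), inv_inv, add_comm] at h
  rw [RS_aeval_Phi hg hx]
  have hxn : x ^ n ≠ 0 := pow_ne_zero _ hx
  rw [inv_pow, inv_pow, show x ^ (2 * n) = x ^ n * x ^ n by ring] at h
  generalize aeval (x + x⁻¹) g = z at h ⊢
  field_simp at h
  linear_combination h

lemma RS_coeff_zero_Phi (n : ℕ) (g : F[X]) : (RSPhi n g).coeff 0 = g.coeff n := by
  rw [RSPhi, finsetSum_coeff, Finset.sum_eq_single n]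
  · simp [coeff_zero_eq_eval_zero]
  · intro i hi hin
    have hi : i ≤ n := by simpa [Nat.lt_succ_iff] using hi
    have : n - i ≠ 0 := by omega
    simp [coeff_zero_eq_eval_zero, this]
  · simp

lemma RS_quad (y : AlgebraicClosure F) : ∃ x : AlgebraicClosure F, x ≠ 0 ∧ x + x⁻¹ = y := by
  have hd : (X ^ 2 - C y * X + 1 : (AlgebraicClosure F)[X]).degree = 2 := by compute_degree!
  obtain ⟨x, hx⟩ := IsAlgClosed.exists_root _ (by rw [hd]; norm_num)
  simp only [IsRoot, eval_add, eval_sub, eval_mul, eval_pow, eval_X, eval_C, eval_one] at hx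
  have hx0 : x ≠ 0 := by rintro rfl; simp at hx
  refine ⟨x, hx0, ?_⟩
  field_simp
  linear_combination hx

lemma RS_Phi_inj {n : ℕ} {g h : F[X]} (hg : g.natDegree ≤ n) (hh : h.natDegree ≤ n)
    (he : RSPhi n g = RSPhi n h) : g = h := by
  apply RS_eq_of_aeval
  intro y _
  obtain ⟨x, hx, rfl⟩ := RS_quad y
  apply mul_left_cancel₀ (pow_ne_zero n hx)
  rw [← RS_aeval_Phi hg hx, ← RS_aeval_Phi hh hx, he]

lemma RS_Phi_surj : ∀ (n : ℕ) (p : F[X]), p.natDegree ≤ 2 * n → reflect (2 * n) p = p →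
    ∃ g : F[X], g.natDegree ≤ n ∧ RSPhi n g = p := by
  intro n
  induction n with
  | zero =>
    intro p hp _
    refine ⟨p, hp, ?_⟩
    rw [RSPhi]
    simp
    exact (eq_C_of_natDegree_le_zero hp).symm
  | succ n ih =>
    intro p hp hr
    have hXm : (X ^ (n + 1) : F[X]).natDegree ≤ n + 1 := natDegree_X_pow_le _
    have hP1 : RSPhi (n + 1) (X ^ (n + 1) : F[X]) = (X ^ 2 + 1) ^ (n + 1) := by
      rw [RSPhi, Finset.sum_eq_single (n + 1)]
      · simp
      · intro i _ hi; simp [coeff_X_pow, hi]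
      · simp
    set u := p - C (p.coeff 0) * RSPhi (n + 1) (X ^ (n + 1) : F[X]) with hu
    have hur : reflect (2 * (n + 1)) u = u := by
      rw [hu, reflect_sub, reflect_C_mul, RS_reflect_Phi hXm, hr]
    have hu0 : u.coeff 0 = 0 := by
      rw [hu, coeff_sub, coeff_C_mul, RS_coeff_zero_Phi]; simp
    have hud : u.natDegree ≤ 2 * (n + 1) := by
      refine (natDegree_sub_le _ _).trans (max_le hp ?_)
      exact (natDegree_C_mul_le _ _).trans (RS_natDegree_Phi _ _)
    have hsym : ∀ i ≤ 2 * (n + 1), u.coeff i = u.coeff (2 * (n + 1) - i) := by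
      intro i hi
      conv_lhs => rw [← hur]
      rw [coeff_reflect, revAt_le hi]
    obtain ⟨r, hr⟩ := X_dvd_iff.mpr hu0
    have hrc : ∀ i, r.coeff i = u.coeff (i + 1) := by intro i; rw [hr, coeff_X_mul]
    have hrd : r.natDegree ≤ 2 * n := by
      rw [natDegree_le_iff_coeff_eq_zero]
      intro N hN
      rw [hrc]
      by_cases hN2 : N + 1 = 2 * (n + 1)
      · rw [hsym _ hN2.le, hN2, Nat.sub_self, hu0]
      · exact coeff_eq_zero_of_natDegree_lt (by omega)
    have hrr : reflect (2 * n) r = r := by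
      ext i
      rw [coeff_reflect]
      by_cases hi : i ≤ 2 * n
      · rw [revAt_le hi, hrc, hrc, hsym (i + 1) (by omega)]
        congr 1; omega
      · rw [revAt_eq_self_of_lt (by omega)]
    obtain ⟨g, hg, hgr⟩ := ih r hrd hrr
    refine ⟨g + C (p.coeff 0) * X ^ (n + 1), ?_, ?_⟩
    · refine (natDegree_add_le _ _).trans (max_le (by omega) ?_)
      exact (natDegree_C_mul_le _ _).trans hXm
    · apply RS_eq_of_aeval
      intro x hx
      rw [RS_aeval_Phi ?_ hx]
      · have e1 : p = u + C (p.coeff 0) * RSPhi (n + 1) (X ^ (n + 1) : F[X]) := by rw [hu]; ring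
        conv_rhs => rw [e1, hr, ← hgr]
        simp only [map_add, map_mul, aeval_C, aeval_X, RS_aeval_Phi hg hx, RS_aeval_Phi hXm hx]
        ring
      · refine (natDegree_add_le _ _).trans (max_le (by omega) ?_)
        exact (natDegree_C_mul_le _ _).trans hXm

lemma RS_sqfree_iff [PerfectField F] (p : F[X]) : Squarefree p ↔
    ∀ a : AlgebraicClosure F, aeval a p ≠ 0 ∨ aeval a (derivative p) ≠ 0 := by
  rw [← PerfectField.separable_iff_squarefree, Separable]
  exact isCoprime_iff_aeval_ne_zero_of_isAlgClosed F (AlgebraicClosure F) p (derivative p)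

lemma RS_sqfree_Phi [PerfectField F] [CharP F 2] {n : ℕ} {g : F[X]} (hg : g.natDegree = n)
    (hm : g.Monic) : Squarefree (RSPhi n g) ↔ Squarefree g ∧ g.coeff 0 ≠ 0 := by
  haveI : CharP (AlgebraicClosure F) 2 := charP_of_injective_algebraMap
    (algebraMap F (AlgebraicClosure F)).injective 2
  have key : ∀ x : AlgebraicClosure F, x ≠ 0 →
      ((aeval x (RSPhi n g) ≠ 0 ∨ aeval x (derivative (RSPhi n g)) ≠ 0) ↔
        (aeval (x + x⁻¹) g ≠ 0 ∨ (x + x⁻¹ ≠ 0 ∧ aeval (x + x⁻¹) (derivative g) ≠ 0))) := by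
    intro x hx
    have h1 := RS_aeval_Phi hg.le hx
    have h2 := RS_aeval_Phi_deriv hg.le hx
    rw [CharTwo.sub_eq_add] at h2
    have hxn : x ^ n ≠ 0 := pow_ne_zero _ hx
    by_cases h0 : aeval (x + x⁻¹) g = 0
    · rw [h0, mul_zero] at h1
      rw [h1, mul_zero, zero_add] at h2
      have h3 : aeval x (derivative (RSPhi n g)) ≠ 0 ↔
        x * aeval x (derivative (RSPhi n g)) ≠ 0 := by simp [hx]
      rw [h3, h2]
      simp [h1, h0, hx]
    · simp [h1, h0, hx]
  have hz : aeval (0 : AlgebraicClosure F) (RSPhi n g) ≠ 0 := by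
    rw [← coeff_zero_eq_aeval_zero', RS_coeff_zero_Phi, ← hg]
    simp [hm]
  rw [RS_sqfree_iff, RS_sqfree_iff]
  have hg0 : aeval (0 : AlgebraicClosure F) g ≠ 0 ↔ g.coeff 0 ≠ 0 := by
    rw [← coeff_zero_eq_aeval_zero']; simp
  rw [← hg0]
  constructor
  · intro h
    constructor
    · intro y
      obtain ⟨x, hx, rfl⟩ := RS_quad y
      have := (key x hx).mp (h x)
      tauto
    · obtain ⟨x, hx, hxy⟩ := RS_quad (0 : AlgebraicClosure F)
      have := (key x hx).mp (h x)
      rw [hxy] at this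
      tauto
  · rintro ⟨h, h0⟩ x
    by_cases hx : x = 0
    · subst hx; exact Or.inl hz
    · rw [key x hx]
      by_cases hy : x + x⁻¹ = 0
      · rw [hy]; exact Or.inl h0
      · have := h (x + x⁻¹)
        tauto

lemma RS_image [PerfectField F] [CharP F 2] (n : ℕ) :
    {p : F[X] | p.Monic ∧ Squarefree p ∧ p.natDegree = 2 * n ∧ p.coeff 0 = 1 ∧
        C (p.coeff 0)⁻¹ * p.reverse = p} =
    RSPhi n '' {p : F[X] | p.Monic ∧ Squarefree p ∧ p.natDegree = n ∧ p.coeff 0 ≠ 0} := by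
  ext p
  constructor
  · rintro ⟨hm, hs, hd, h0, hr⟩
    rw [h0] at hr
    simp only [inv_one, C_1, one_mul, reverse, hd] at hr
    obtain ⟨g, hg, rfl⟩ := RS_Phi_surj n p hd.le hr
    rw [RS_coeff_zero_Phi] at h0
    have hgm : g.Monic := monic_of_natDegree_le_of_coeff_eq_one n hg h0
    have hgd : g.natDegree = n := le_antisymm hg (le_natDegree_of_ne_zero (by rw [h0]; simp))
    have := (RS_sqfree_Phi hgd hgm).mp hs
    exact ⟨g, ⟨hgm, this.1, hgd, this.2⟩, rfl⟩
  · rintro ⟨g, ⟨hm, hs, hd, h0⟩, rfl⟩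
    have hgn : g.coeff n = 1 := by rw [← hd]; exact hm
    have hc0 : (RSPhi n g).coeff 0 = 1 := by rw [RS_coeff_zero_Phi, hgn]
    have hr := RS_reflect_Phi hd.le
    have hc1 : (RSPhi n g).coeff (2 * n) = 1 := by
      rw [← hr, coeff_reflect, revAt_le le_rfl, Nat.sub_self, hc0]
    have hdeg : (RSPhi n g).natDegree = 2 * n :=
      le_antisymm (RS_natDegree_Phi n g) (le_natDegree_of_ne_zero (by rw [hc1]; simp))
    refine ⟨monic_of_natDegree_le_of_coeff_eq_one _ hdeg.le hc1,
      (RS_sqfree_Phi hd hm).mpr ⟨hs, h0⟩, hdeg, hc0, ?_⟩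
    rw [hc0, reverse, hdeg, hr]; simp

end

end RSaux

/-- For `q` even and `n ≥ 1`, the number of monic squarefree `*`-self-conjugate
polynomials of degree `2n` over `F_q` with constant term `1` (the regular semisimple
classes of `Sp(2n,q)`) equals `((q-1)/(q+1))(q^n + (-1)^{n-1})`, which is the same
as the number of regular semisimple classes of `GL(n,q)` (monic squarefree degree-`n`
polynomials with nonzero constant term). Here `φ* = φ(0)⁻¹ t^{deg φ} φ(1/t)`. -/
theorem regular_semisimple_classes_Sp_even_char (q n : ℕ) (hn : 1 ≤ n) (hq2 : Even q)
    (F : Type*) [Field F] [Fintype F] (hq : Fintype.card F = q) :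
    ({p : Polynomial F | p.Monic ∧ Squarefree p ∧ p.natDegree = 2 * n ∧ p.coeff 0 = 1 ∧
        Polynomial.C (p.coeff 0)⁻¹ * p.reverse = p}.ncard : ℤ) * ((q : ℤ) + 1)
      = ((q : ℤ) - 1) * ((q : ℤ) ^ n + (-1) ^ (n - 1)) ∧
    {p : Polynomial F | p.Monic ∧ Squarefree p ∧ p.natDegree = 2 * n ∧ p.coeff 0 = 1 ∧
        Polynomial.C (p.coeff 0)⁻¹ * p.reverse = p}.ncard
      = {p : Polynomial F | p.Monic ∧ Squarefree p ∧ p.natDegree = n ∧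
          p.coeff 0 ≠ 0}.ncard := by
  subst hq
  have hch : ringChar F = 2 := FiniteField.even_card_iff_char_two.mpr (Nat.even_iff.mp hq2)
  have : CharP F 2 := ringChar.of_eq hch
  have hcard : {p : Polynomial F | p.Monic ∧ Squarefree p ∧ p.natDegree = 2 * n ∧ p.coeff 0 = 1 ∧
        Polynomial.C (p.coeff 0)⁻¹ * p.reverse = p}.ncard
      = {p : Polynomial F | p.Monic ∧ Squarefree p ∧ p.natDegree = n ∧
          p.coeff 0 ≠ 0}.ncard := by
    rw [RS_image]
    apply Set.InjOn.ncard_image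
    intro g hg h hh he
    exact RS_Phi_inj hg.2.2.1.le hh.2.2.1.le he
  refine ⟨?_, hcard⟩
  rw [hcard]
  obtain ⟨m, rfl⟩ := Nat.exists_eq_add_of_le' hn
  exact RS_count F m
end
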